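/- Let g ∈ U(2) have eigenvalues μ_1, μ_2 (unit complex numbers). Then for all natural numbers p, q, the trace of g acting on H_{p,q}(S^3) equals μ_1^{−p}·μ_2^{q}·Σ_{j=0}^{p+q} (μ_1/μ_2)^j. In particular, dim_ℂ H_{p,q}(S^3) = p+q+1. -/

import Mathlib

noncomputable section

open MvPolynomial Matrix Complex Real Filter

/-- Variables: `Sum.inl i` is `z i`, `Sum.inr i` is `conj (z i)`. -/
abbrev Var (n : ℕ) := Fin n ⊕ Fin n

/-- Bidegree weight: `z`-variables have weight (1,0), `z̄`-variables weight (0,1). -/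
def bidegWt (n : ℕ) : Var n → ℕ × ℕ :=
  Sum.elim (fun _ => ((1 : ℕ), (0 : ℕ))) (fun _ => ((0 : ℕ), (1 : ℕ)))

/-- The Laplacian `∑ i, ∂²/∂zᵢ∂z̄ᵢ` on polynomials in `z, z̄`. -/
def kohnLap (n : ℕ) : MvPolynomial (Var n) ℂ →ₗ[ℂ] MvPolynomial (Var n) ℂ :=
  ∑ i : Fin n, ((pderiv (R := ℂ) (Sum.inl i)).toLinearMap.comp
    (pderiv (R := ℂ) (Sum.inr i)).toLinearMap)

/-- `H_{p,q}`: harmonic polynomials on ℂⁿ of bidegree `(p,q)`. -/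
def Hpq (n p q : ℕ) : Submodule ℂ (MvPolynomial (Var n) ℂ) :=
  (weightedHomogeneousSubmodule ℂ (bidegWt n) (p, q)) ⊓ (LinearMap.ker (kohnLap n))

/-- The action of a unitary matrix `g` on polynomials, `(g · f)(z) = f(g⁻¹ z)`:
substitution `zᵢ ↦ ∑ⱼ (g⁻¹)ᵢⱼ zⱼ`, `z̄ᵢ ↦ ∑ⱼ conj((g⁻¹)ᵢⱼ) z̄ⱼ`. -/
def uAct (n : ℕ) (g : Matrix.unitaryGroup (Fin n) ℂ) :
    MvPolynomial (Var n) ℂ →ₐ[ℂ] MvPolynomial (Var n) ℂ :=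
  aeval (Sum.elim
    (fun i => ∑ j : Fin n,
      MvPolynomial.C ((g⁻¹ : Matrix.unitaryGroup (Fin n) ℂ) i j) * X (Sum.inl j))
    (fun i => ∑ j : Fin n,
      MvPolynomial.C ((starRingEnd ℂ) ((g⁻¹ : Matrix.unitaryGroup (Fin n) ℂ) i j)) * X (Sum.inr j)))

/-- `H_{p,q}^S`: the subspace of `H_{p,q}` invariant under every element of `S`. -/
def HpqInv (n p q : ℕ) (S : Set (Matrix.unitaryGroup (Fin n) ℂ)) :
    Submodule ℂ (MvPolynomial (Var n) ℂ) :=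
  Hpq n p q ⊓ (⨅ g ∈ S, LinearMap.ker ((uAct n g).toLinearMap - LinearMap.id))

/-- `dim_ℂ H_{p,q}^S`. -/
def dimHpqInv (n p q : ℕ) (S : Set (Matrix.unitaryGroup (Fin n) ℂ)) : ℕ :=
  Module.finrank ℂ (HpqInv n p q S)

/-- A set of unitary matrices acts freely on the sphere iff no element other than
the identity has `1` as an eigenvalue. -/
def actsFreely {n : ℕ} (S : Set (Matrix.unitaryGroup (Fin n) ℂ)) : Prop :=
  ∀ g ∈ S, ((g : Matrix (Fin n) (Fin n) ℂ) - 1).det = 0 → g = 1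

/-- The character `χ_{H_{p,q}}(g)`: the trace of `g` acting on `H_{p,q}`
(the action does map `H_{p,q}` to itself). -/
def charHpq (n p q : ℕ) (g : Matrix.unitaryGroup (Fin n) ℂ) : ℂ :=
  letI := Classical.propDecidable
  if h : ∀ f ∈ Hpq n p q, uAct n g f ∈ Hpq n p q then
    LinearMap.trace ℂ (Hpq n p q) ((uAct n g).toLinearMap.restrict h)
  else 0


/-! ### The unitary action -/

lemma uAct_X_inl {n : ℕ} (g : unitaryGroup (Fin n) ℂ) (i : Fin n) :
    uAct n g (X (Sum.inl i)) = ∑ j, C ((g⁻¹ : unitaryGroup (Fin n) ℂ) i j) * X (Sum.inl j) := by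
  simp [uAct]

lemma uAct_X_inr {n : ℕ} (g : unitaryGroup (Fin n) ℂ) (i : Fin n) :
    uAct n g (X (Sum.inr i)) =
      ∑ j, C (starRingEnd ℂ ((g⁻¹ : unitaryGroup (Fin n) ℂ) i j)) * X (Sum.inr j) := by
  simp [uAct]

lemma uAct_C {n : ℕ} (g : unitaryGroup (Fin n) ℂ) (c : ℂ) : uAct n g (C c) = C c :=
  (uAct n g).commutes c

lemma uAct_mul {n : ℕ} (g h : unitaryGroup (Fin n) ℂ) (f : MvPolynomial (Var n) ℂ) :
    uAct n (g * h) f = uAct n g (uAct n h f) := by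
  suffices uAct n (g * h) = (uAct n g).comp (uAct n h) from DFunLike.congr_fun this f
  ext1 (i | i)
  · simp only [AlgHom.comp_apply, uAct_X_inl, map_sum, map_mul, uAct_C, _root_.mul_inv_rev,
      UnitaryGroup.mul_val, Matrix.mul_apply, Finset.sum_mul, Finset.mul_sum, mul_assoc]
    exact Finset.sum_comm
  · simp only [AlgHom.comp_apply, uAct_X_inr, map_sum, map_mul, uAct_C, _root_.mul_inv_rev,
      UnitaryGroup.mul_val, Matrix.mul_apply, Finset.sum_mul, Finset.mul_sum, mul_assoc]
    exact Finset.sum_comm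

lemma pderiv_inl_uAct {n : ℕ} (g : unitaryGroup (Fin n) ℂ) (i : Fin n)
    (f : MvPolynomial (Var n) ℂ) :
    pderiv (Sum.inl i) (uAct n g f) =
      ∑ k, C ((g⁻¹ : unitaryGroup (Fin n) ℂ) k i) * uAct n g (pderiv (Sum.inl k) f) := by
  induction f using MvPolynomial.induction_on with
  | C a => simp
  | add f₁ f₂ h₁ h₂ => simp [h₁, h₂, mul_add, Finset.sum_add_distrib]
  | mul_X f v h =>
    simp only [map_mul, pderiv_mul, h, map_add, mul_add, Finset.sum_add_distrib, Finset.sum_mul,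
      mul_assoc]
    congr 1
    rcases v with v | v
    · simp [uAct_X_inl, pderiv_X, Pi.single_apply, apply_ite (uAct n g), mul_comm]
    · simp [uAct_X_inr, pderiv_X]

lemma pderiv_inr_uAct {n : ℕ} (g : unitaryGroup (Fin n) ℂ) (i : Fin n)
    (f : MvPolynomial (Var n) ℂ) :
    pderiv (Sum.inr i) (uAct n g f) =
      ∑ k, C (starRingEnd ℂ ((g⁻¹ : unitaryGroup (Fin n) ℂ) k i)) *
        uAct n g (pderiv (Sum.inr k) f) := by
  induction f using MvPolynomial.induction_on with
  | C a => simp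
  | add f₁ f₂ h₁ h₂ => simp [h₁, h₂, mul_add, Finset.sum_add_distrib]
  | mul_X f v h =>
    simp only [map_mul, pderiv_mul, h, map_add, mul_add, Finset.sum_add_distrib, Finset.sum_mul,
      mul_assoc]
    congr 1
    rcases v with v | v
    · simp [uAct_X_inl, pderiv_X]
    · simp [uAct_X_inr, pderiv_X, Pi.single_apply, apply_ite (uAct n g), mul_comm]

lemma kohnLap_apply {n : ℕ} (f : MvPolynomial (Var n) ℂ) :
    kohnLap n f = ∑ i, pderiv (Sum.inl i) (pderiv (Sum.inr i) f) := by
  simp [kohnLap]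

lemma kohnLap_uAct {n : ℕ} (g : unitaryGroup (Fin n) ℂ) (f : MvPolynomial (Var n) ℂ) :
    kohnLap n (uAct n g f) = uAct n g (kohnLap n f) := by
  have hortho (k l : Fin n) : ∑ i, starRingEnd ℂ ((g⁻¹ : unitaryGroup (Fin n) ℂ) k i) *
      (g⁻¹ : unitaryGroup (Fin n) ℂ) l i = if l = k then 1 else 0 := by
    have h := congrFun₂ (mem_unitaryGroup_iff.mp g⁻¹.2) l k
    simpa [Matrix.mul_apply, Matrix.one_apply, mul_comm] using h
  simp only [kohnLap_apply, pderiv_inr_uAct, map_sum, pderiv_C_mul, pderiv_inl_uAct,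
    Finset.mul_sum, ← mul_assoc, ← C_mul]
  rw [Finset.sum_comm]
  refine Finset.sum_congr rfl fun k _ => ?_
  rw [Finset.sum_comm]
  simp only [← Finset.sum_mul, ← map_sum, hortho]
  simp [ite_mul]

lemma isWeightedHomogeneous_uAct {n : ℕ} (g : unitaryGroup (Fin n) ℂ)
    {f : MvPolynomial (Var n) ℂ} {d : ℕ × ℕ} (hf : IsWeightedHomogeneous (bidegWt n) f d) :
    IsWeightedHomogeneous (bidegWt n) (uAct n g f) d := by
  have hX (v : Var n) : IsWeightedHomogeneous (bidegWt n) (uAct n g (X v)) (bidegWt n v) := by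
    rcases v with i | i
    · rw [uAct_X_inl]
      exact IsWeightedHomogeneous.sum _ _ _ fun j _ =>
        (isWeightedHomogeneous_X ℂ (bidegWt n) (Sum.inl j)).C_mul _
    · rw [uAct_X_inr]
      exact IsWeightedHomogeneous.sum _ _ _ fun j _ =>
        (isWeightedHomogeneous_X ℂ (bidegWt n) (Sum.inr j)).C_mul _
  induction hf using IsWeightedHomogeneous.induction_on with
  | zero => simpa using isWeightedHomogeneous_zero ℂ (bidegWt n) d
  | add f₁ f₂ _ _ h₁ h₂ => simpa using h₁.add h₂
  | monomial m r hm =>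
    rw [monomial_eq, Finsupp.prod, map_mul, uAct_C, map_prod, ← hm, Finsupp.weight_apply,
      Finsupp.sum]
    refine (IsWeightedHomogeneous.prod _ _ _ fun v _ => ?_).C_mul r
    rw [map_pow]
    exact (hX v).pow _

lemma uAct_mem_Hpq {n p q : ℕ} (g : unitaryGroup (Fin n) ℂ) :
    ∀ f ∈ Hpq n p q, uAct n g f ∈ Hpq n p q := by
  rintro f ⟨hf, hlap⟩
  refine ⟨isWeightedHomogeneous_uAct g hf, ?_⟩
  rw [SetLike.mem_coe, LinearMap.mem_ker] at hlap ⊢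
  rw [kohnLap_uAct, hlap, map_zero]

lemma charHpq_eq_trace (n p q : ℕ) (g : unitaryGroup (Fin n) ℂ) :
    charHpq n p q g =
      LinearMap.trace ℂ (Hpq n p q) ((uAct n g).toLinearMap.restrict (uAct_mem_Hpq g)) :=
  dif_pos _

lemma charHpq_conj (n p q : ℕ) (u g : unitaryGroup (Fin n) ℂ) :
    charHpq n p q (u * g * u⁻¹) = charHpq n p q g := by
  have hmul (g h : unitaryGroup (Fin n) ℂ) :
      (uAct n (g * h)).toLinearMap.restrict (uAct_mem_Hpq (p := p) (q := q) (g * h)) =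
        (uAct n g).toLinearMap.restrict (uAct_mem_Hpq g) *
          (uAct n h).toLinearMap.restrict (uAct_mem_Hpq h) := by
    ext1 f
    exact Subtype.ext (uAct_mul g h f)
  rw [charHpq_eq_trace, hmul, LinearMap.trace_mul_comm, ← hmul, ← charHpq_eq_trace]
  simp

/-! ### Diagonalisation of 2 × 2 unitary matrices -/

open ComplexConjugate in
lemma exists_unitary_conj_diagonal (g : unitaryGroup (Fin 2) ℂ) {μ₁ μ₂ : ℂ}
    (hchar : Matrix.charpoly (g : Matrix (Fin 2) (Fin 2) ℂ) =
      (Polynomial.X - Polynomial.C μ₁) * (Polynomial.X - Polynomial.C μ₂)) :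
    ∃ u d : unitaryGroup (Fin 2) ℂ, g = u * d * u⁻¹ ∧
      (d : Matrix (Fin 2) (Fin 2) ℂ) = Matrix.diagonal ![μ₁, μ₂] := by
  obtain ⟨v, hv, hgv⟩ : ∃ v ≠ 0, ((g : Matrix (Fin 2) (Fin 2) ℂ) - scalar (Fin 2) μ₁) *ᵥ v = 0 := by
    rw [Matrix.exists_mulVec_eq_zero_iff, ← neg_sub, det_neg, ← Matrix.eval_charpoly, hchar]
    simp
  have hgv' : (g : Matrix (Fin 2) (Fin 2) ℂ) *ᵥ v = μ₁ • v := by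
    rw [Matrix.sub_mulVec, sub_eq_zero] at hgv
    rw [hgv]
    ext i
    simp [Matrix.scalar_apply, Matrix.mulVec_diagonal]
  have hpos : 0 < normSq (v 0) + normSq (v 1) := by
    by_contra! hle
    have h₀ := normSq_nonneg (v 0)
    have h₁ := normSq_nonneg (v 1)
    refine hv (funext fun i => normSq_eq_zero.mp ?_)
    fin_cases i
    · exact le_antisymm (by simp only [Fin.zero_eta]; linarith) h₀
    · exact le_antisymm (by simp only [Fin.mk_one]; linarith) h₁
  obtain ⟨x, y, hxy, hgx, hgy⟩ : ∃ x y : ℂ, x * conj x + y * conj y = 1 ∧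
      g 0 0 * x + g 0 1 * y = μ₁ * x ∧ g 1 0 * x + g 1 1 * y = μ₁ * y := by
    set r : ℝ := √(normSq (v 0) + normSq (v 1)) with hr
    have hr0 : (r : ℂ) ≠ 0 := by exact_mod_cast (Real.sqrt_pos.mpr hpos).ne'
    have hr2 : (r : ℂ) ^ 2 = v 0 * conj (v 0) + v 1 * conj (v 1) := by
      rw [mul_conj, mul_conj]
      exact_mod_cast Real.sq_sqrt hpos.le
    have h₀ := congrFun hgv' 0
    have h₁ := congrFun hgv' 1
    simp only [Matrix.mulVec, dotProduct, Fin.sum_univ_two, Pi.smul_apply, smul_eq_mul] at h₀ h₁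
    refine ⟨v 0 / r, v 1 / r, ?_, ?_, ?_⟩
    · simp only [map_div₀, conj_ofReal]
      field_simp
      exact hr2.symm
    · field_simp
      linear_combination h₀
    · field_simp
      linear_combination h₁
  let u : unitaryGroup (Fin 2) ℂ := ⟨!![x, -conj y; y, conj x], by
    rw [mem_unitaryGroup_iff']
    ext i j
    fin_cases i <;> fin_cases j <;> simp [Matrix.mul_apply, Fin.sum_univ_two] <;> grind⟩
  have hu : (u : Matrix (Fin 2) (Fin 2) ℂ) = !![x, -conj y; y, conj x] := rfl
  set d : unitaryGroup (Fin 2) ℂ := u⁻¹ * g * u with hd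
  have hdval : (d : Matrix (Fin 2) (Fin 2) ℂ) = star (u : Matrix (Fin 2) (Fin 2) ℂ) * g * u := rfl
  have h00 : d 0 0 = μ₁ := by
    simp [hdval, hu, Matrix.mul_apply, Fin.sum_univ_two]
    linear_combination conj x * hgx + conj y * hgy + μ₁ * hxy
  have h10 : d 1 0 = 0 := by
    simp [hdval, hu, Matrix.mul_apply, Fin.sum_univ_two]
    linear_combination x * hgy - y * hgx
  have hunit := mem_unitaryGroup_iff'.mp d.2
  have hμ₁ : conj μ₁ * μ₁ = 1 := by
    simpa [Matrix.mul_apply, Fin.sum_univ_two, h00, h10] using congrFun₂ hunit 0 0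
  have h01 : d 0 1 = 0 := by
    have h : conj μ₁ * d 0 1 = 0 := by
      simpa [Matrix.mul_apply, Fin.sum_univ_two, h00, h10] using congrFun₂ hunit 0 1
    linear_combination μ₁ * h - d 0 1 * hμ₁
  have htrace : d 0 0 + d 1 1 = μ₁ + μ₂ := by
    have hg : (g : Matrix (Fin 2) (Fin 2) ℂ).trace = μ₁ + μ₂ := by
      rw [Matrix.trace_eq_neg_charpoly_coeff, hchar]
      have : (Polynomial.X - Polynomial.C μ₁) * (Polynomial.X - Polynomial.C μ₂) =
          Polynomial.X ^ 2 - Polynomial.C (μ₁ + μ₂) * Polynomial.X + Polynomial.C (μ₁ * μ₂) := by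
        simp only [map_add, map_mul]
        ring
      simp [this, Polynomial.coeff_C]
    rw [← hg, ← Matrix.trace_fin_two, hdval, Matrix.trace_mul_cycle,
      mem_unitaryGroup_iff.mp u.2, Matrix.one_mul]
  refine ⟨u, d, by simp [hd, mul_assoc], ?_⟩
  ext i j
  fin_cases i <;> fin_cases j
  · simpa using h00
  · simpa using h01
  · simpa using h10
  · simpa [h00] using htrace
/-! ### Coefficients of harmonic polynomials on `ℂ²` -/

lemma weight_bidegWt_two (m : Var 2 →₀ ℕ) :
    Finsupp.weight (bidegWt 2) m =
      (m (Sum.inl 0) + m (Sum.inl 1), m (Sum.inr 0) + m (Sum.inr 1)) := by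
  ext <;> simp [Finsupp.weight_apply, Finsupp.sum_fintype, bidegWt, Fin.sum_univ_two]

lemma coeff_kohnLap_two (f : MvPolynomial (Var 2) ℂ) (m : Var 2 →₀ ℕ) :
    coeff m (kohnLap 2 f) =
      (m (Sum.inl 0) + 1) * (m (Sum.inr 0) + 1) *
        coeff (m + Finsupp.single (Sum.inl 0) 1 + Finsupp.single (Sum.inr 0) 1) f +
      (m (Sum.inl 1) + 1) * (m (Sum.inr 1) + 1) *
        coeff (m + Finsupp.single (Sum.inl 1) 1 + Finsupp.single (Sum.inr 1) 1) f := by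
  simp [kohnLap_apply, Fin.sum_univ_two, coeff_pderiv]
  ring

/-- The coefficients of a harmonic polynomial, divided by `harmonicWeight`, depend only on the
sum of the exponents of `z₁` and `z̄₀`. -/
def harmonicWeight (m : Var 2 →₀ ℕ) : ℂ :=
  (-1) ^ m (Sum.inr 0) / ∏ v, ((m v).factorial : ℂ)

lemma harmonicWeight_ne_zero (m : Var 2 →₀ ℕ) : harmonicWeight m ≠ 0 :=
  div_ne_zero (pow_ne_zero _ (by norm_num))
    (Finset.prod_ne_zero_iff.mpr fun v _ => Nat.cast_ne_zero.mpr (Nat.factorial_ne_zero _))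

lemma harmonicWeight_add_zero (m : Var 2 →₀ ℕ) :
    (m (Sum.inl 0) + 1) * (m (Sum.inr 0) + 1) *
      harmonicWeight (m + Finsupp.single (Sum.inl 0) 1 + Finsupp.single (Sum.inr 0) 1) =
        -harmonicWeight m := by
  have h (k : ℕ) : (k : ℂ) + 1 ≠ 0 := Nat.cast_add_one_ne_zero k
  simp [harmonicWeight, Nat.factorial_succ, pow_succ, Fin.prod_univ_two]
  field_simp [h]

lemma harmonicWeight_add_one (m : Var 2 →₀ ℕ) :
    (m (Sum.inl 1) + 1) * (m (Sum.inr 1) + 1) *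
      harmonicWeight (m + Finsupp.single (Sum.inl 1) 1 + Finsupp.single (Sum.inr 1) 1) =
        harmonicWeight m := by
  have h (k : ℕ) : (k : ℂ) + 1 ≠ 0 := Nat.cast_add_one_ne_zero k
  simp [harmonicWeight, Nat.factorial_succ, Fin.prod_univ_two]
  field_simp [h]

/-- The exponents of bidegree `(p, q)`. -/
def bidegExponents (p q : ℕ) : Finset (Var 2 →₀ ℕ) :=
  (Finset.univ.finsuppAntidiag (p + q)).filter fun m =>
    m (Sum.inl 0) + m (Sum.inl 1) = p ∧ m (Sum.inr 0) + m (Sum.inr 1) = q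

lemma mem_bidegExponents {p q : ℕ} {m : Var 2 →₀ ℕ} :
    m ∈ bidegExponents p q ↔
      m (Sum.inl 0) + m (Sum.inl 1) = p ∧ m (Sum.inr 0) + m (Sum.inr 1) = q := by
  simp only [bidegExponents, Finset.mem_filter, Finset.mem_finsuppAntidiag, Fintype.sum_sum_type,
    Fin.sum_univ_two, Finset.subset_univ]
  grind

/-- The sum of the exponents of `z₁` and `z̄₀`. -/
def shiftDeg (m : Var 2 →₀ ℕ) : ℕ := m (Sum.inl 1) + m (Sum.inr 0)

/-- The polynomial of bidegree `(p, q)` with coefficients `harmonicWeight m * h (shiftDeg m)`. -/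
def harmonicPoly (p q : ℕ) (h : ℕ → ℂ) : MvPolynomial (Var 2) ℂ :=
  ∑ m ∈ bidegExponents p q, monomial m (harmonicWeight m * h (shiftDeg m))

lemma coeff_harmonicPoly (p q : ℕ) (h : ℕ → ℂ) (m : Var 2 →₀ ℕ) :
    coeff m (harmonicPoly p q h) =
      if m ∈ bidegExponents p q then harmonicWeight m * h (shiftDeg m) else 0 := by
  classical
  simp [harmonicPoly, coeff_sum, coeff_monomial]

lemma harmonicPoly_mem (p q : ℕ) (h : ℕ → ℂ) : harmonicPoly p q h ∈ Hpq 2 p q := by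
  constructor
  · intro m hm
    rw [coeff_harmonicPoly] at hm
    rw [weight_bidegWt_two]
    obtain ⟨h₁, h₂⟩ := mem_bidegExponents.mp (ite_ne_right_iff.mp hm).1
    rw [h₁, h₂]
  · rw [SetLike.mem_coe, LinearMap.mem_ker]
    ext m
    have hs : shiftDeg (m + Finsupp.single (Sum.inl 0) 1 + Finsupp.single (Sum.inr 0) 1) =
        shiftDeg (m + Finsupp.single (Sum.inl 1) 1 + Finsupp.single (Sum.inr 1) 1) := by
      simp [shiftDeg]
      ring
    have hmem : m + Finsupp.single (Sum.inl 0) 1 + Finsupp.single (Sum.inr 0) 1 ∈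
        bidegExponents p q ↔
        m + Finsupp.single (Sum.inl 1) 1 + Finsupp.single (Sum.inr 1) 1 ∈
          bidegExponents p q := by
      simp [mem_bidegExponents]
      grind
    rw [coeff_kohnLap_two, coeff_harmonicPoly, coeff_harmonicPoly, hs]
    simp only [hmem]
    split_ifs
    · rw [← mul_assoc, ← mul_assoc, harmonicWeight_add_zero, harmonicWeight_add_one, coeff_zero]
      ring
    · simp

/-- The exponent of bidegree `(p, q)` and shift degree `j ≤ p + q` with the least possible
power of `z̄₀`. -/
def leastExponent (p q j : ℕ) : Var 2 →₀ ℕ :=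
  Finsupp.equivFunOnFinite.symm
    (Sum.elim ![p - min j p, min j p] ![j - min j p, q - (j - min j p)])

lemma leastExponent_mem {p q j : ℕ} (hj : j ≤ p + q) :
    leastExponent p q j ∈ bidegExponents p q := by
  rw [mem_bidegExponents]
  simp [leastExponent]
  omega

lemma shiftDeg_leastExponent (p q j : ℕ) : shiftDeg (leastExponent p q j) = j := by
  simp [shiftDeg, leastExponent]

lemma eq_leastExponent {p q : ℕ} {m : Var 2 →₀ ℕ} (hm : m ∈ bidegExponents p q)
    (h : m (Sum.inl 0) = 0 ∨ m (Sum.inr 0) = 0) : m = leastExponent p q (shiftDeg m) := by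
  obtain ⟨h₁, h₂⟩ := mem_bidegExponents.mp hm
  ext (v | v) <;> fin_cases v <;> simp [leastExponent, shiftDeg] <;> omega

lemma coeff_eq_of_mem_Hpq {p q : ℕ} {f : MvPolynomial (Var 2) ℂ} (hf : f ∈ Hpq 2 p q)
    {m : Var 2 →₀ ℕ} (hm : m ∈ bidegExponents p q) :
    coeff m f / harmonicWeight m =
      coeff (leastExponent p q (shiftDeg m)) f /
        harmonicWeight (leastExponent p q (shiftDeg m)) := by
  obtain ⟨k, hk⟩ : ∃ k, m (Sum.inr 0) = k := ⟨_, rfl⟩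
  induction k generalizing m with
  | zero => rw [← eq_leastExponent hm (Or.inr hk)]
  | succ k ih =>
    by_cases h0 : m (Sum.inl 0) = 0
    · rw [← eq_leastExponent hm (Or.inl h0)]
    obtain ⟨n, rfl⟩ : ∃ n, m = n + Finsupp.single (Sum.inl 0) 1 + Finsupp.single (Sum.inr 0) 1 := by
      refine ⟨m - Finsupp.single (Sum.inl 0) 1 - Finsupp.single (Sum.inr 0) 1, ?_⟩
      ext (v | v) <;> fin_cases v <;> simp <;> omega
    have hs : shiftDeg (n + Finsupp.single (Sum.inl 0) 1 + Finsupp.single (Sum.inr 0) 1) =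
        shiftDeg (n + Finsupp.single (Sum.inl 1) 1 + Finsupp.single (Sum.inr 1) 1) := by
      simp [shiftDeg]
      ring
    have hn : n + Finsupp.single (Sum.inl 1) 1 + Finsupp.single (Sum.inr 1) 1 ∈
        bidegExponents p q := by
      simp only [mem_bidegExponents] at hm ⊢
      simp at hm ⊢
      omega
    rw [hs, ← ih hn (by simpa using hk), div_eq_div_iff (harmonicWeight_ne_zero _)
      (harmonicWeight_ne_zero _)]
    have hlap := congrArg (coeff n) (LinearMap.mem_ker.mp hf.2)
    rw [coeff_kohnLap_two, coeff_zero] at hlap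
    have h₀ := harmonicWeight_add_zero n
    have h₁ := harmonicWeight_add_one n
    have h (k : ℕ) : (k : ℂ) + 1 ≠ 0 := Nat.cast_add_one_ne_zero k
    refine mul_left_cancel₀ (mul_ne_zero (mul_ne_zero (h (n (Sum.inl 0))) (h (n (Sum.inr 0))))
      (mul_ne_zero (h (n (Sum.inl 1))) (h (n (Sum.inr 1))))) ?_
    linear_combination
      (n (Sum.inl 0) + 1) * (n (Sum.inr 0) + 1) *
        coeff (n + Finsupp.single (Sum.inl 0) 1 + Finsupp.single (Sum.inr 0) 1) f * h₁ -
      (n (Sum.inl 1) + 1) * (n (Sum.inr 1) + 1) *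
        coeff (n + Finsupp.single (Sum.inl 1) 1 + Finsupp.single (Sum.inr 1) 1) f * h₀ +
      harmonicWeight n * hlap

/-- A harmonic polynomial of bidegree `(p, q)` on `ℂ²` is determined by its coefficients at the
exponents `leastExponent p q j`, `j ≤ p + q`, and these are arbitrary. -/
def hpqEquiv (p q : ℕ) : Hpq 2 p q ≃ₗ[ℂ] (Fin (p + q + 1) → ℂ) where
  toFun f j := coeff (leastExponent p q j) (f : MvPolynomial (Var 2) ℂ) /
    harmonicWeight (leastExponent p q j)
  map_add' f g := by
    ext j
    simp [add_div]
  map_smul' c f := by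
    ext j
    simp [mul_div_assoc]
  invFun h := ⟨harmonicPoly p q (Function.extend Fin.val h 0), harmonicPoly_mem p q _⟩
  left_inv f := by
    ext m
    rw [coeff_harmonicPoly]
    split_ifs with hm
    · have hlt : shiftDeg m < p + q + 1 := by
        rw [mem_bidegExponents] at hm
        rw [shiftDeg]
        omega
      have hext := (Fin.val_injective (n := p + q + 1)).extend_apply
        (fun j => coeff (leastExponent p q j) (f : MvPolynomial (Var 2) ℂ) /
          harmonicWeight (leastExponent p q j)) 0 ⟨_, hlt⟩
      rw [hext, ← coeff_eq_of_mem_Hpq f.2 hm, mul_div_cancel₀ _ (harmonicWeight_ne_zero m)]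
    · by_contra hne
      have hw := f.2.1 (Ne.symm hne)
      rw [weight_bidegWt_two, Prod.mk.injEq] at hw
      exact hm (mem_bidegExponents.mpr hw)
  right_inv h := by
    ext j
    have hmem := leastExponent_mem (p := p) (q := q) (Nat.lt_succ_iff.mp j.2)
    simp only [coeff_harmonicPoly, if_pos hmem, shiftDeg_leastExponent,
      Fin.val_injective.extend_apply]
    exact mul_div_cancel_left₀ _ (harmonicWeight_ne_zero _)

/-! ### The character at a diagonal matrix -/

lemma coeff_aeval_C_mul_X {σ R : Type*} [Fintype σ] [CommSemiring R] (c : σ → R)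
    (f : MvPolynomial σ R) (m : σ →₀ ℕ) :
    coeff m (aeval (fun v => C (c v) * X v) f) = (∏ v, c v ^ m v) * coeff m f := by
  classical
  induction f using MvPolynomial.induction_on' with
  | monomial n a =>
    have : aeval (fun v => C (c v) * X v) (monomial n a) =
        monomial n ((∏ v, c v ^ n v) * a) := by
      rw [aeval_monomial, Finsupp.prod_fintype _ _ (by simp), monomial_eq (s := n),
        Finsupp.prod_fintype _ _ (by simp)]
      simp only [mul_pow, Finset.prod_mul_distrib, algebraMap_eq, map_mul, map_prod, map_pow]
      ring
    rw [this, coeff_monomial, coeff_monomial]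
    split_ifs with h
    · rw [h]
    · simp
  | add f g hf hg => rw [map_add, coeff_add, coeff_add, hf, hg, mul_add]

lemma coeff_uAct_of_diagonal {d : unitaryGroup (Fin 2) ℂ} {μ₁ μ₂ : ℂ}
    (hd : (d : Matrix (Fin 2) (Fin 2) ℂ) = Matrix.diagonal ![μ₁, μ₂])
    (f : MvPolynomial (Var 2) ℂ) (m : Var 2 →₀ ℕ) :
    coeff m (uAct 2 d f) = starRingEnd ℂ μ₁ ^ m (Sum.inl 0) * starRingEnd ℂ μ₂ ^ m (Sum.inl 1) *
      (μ₁ ^ m (Sum.inr 0) * μ₂ ^ m (Sum.inr 1)) * coeff m f := by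
  have hinv : ((d⁻¹ : unitaryGroup (Fin 2) ℂ) : Matrix (Fin 2) (Fin 2) ℂ) =
      star (Matrix.diagonal ![μ₁, μ₂]) := by
    rw [← hd]
    rfl
  have huAct : uAct 2 d = aeval (fun v => C (Sum.elim
      ![starRingEnd ℂ μ₁, starRingEnd ℂ μ₂] ![μ₁, μ₂] v) * X v) := by
    ext1 (i | i) <;> fin_cases i <;> simp [uAct_X_inl, uAct_X_inr, hinv]
  rw [huAct, coeff_aeval_C_mul_X]
  simp [Fin.prod_univ_two]

lemma charHpq_of_diagonal {d : unitaryGroup (Fin 2) ℂ} {μ₁ μ₂ : ℂ}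
    (hd : (d : Matrix (Fin 2) (Fin 2) ℂ) = Matrix.diagonal ![μ₁, μ₂]) (p q : ℕ) :
    charHpq 2 p q d =
      μ₁⁻¹ ^ p * μ₂ ^ q * ∑ j ∈ Finset.range (p + q + 1), (μ₁ / μ₂) ^ j := by
  have hunit := mem_unitaryGroup_iff'.mp d.2
  rw [hd] at hunit
  have hμ₁ : starRingEnd ℂ μ₁ * μ₁ = 1 := by
    simpa [Matrix.mul_apply, Fin.sum_univ_two] using congrFun₂ hunit 0 0
  have hμ₂ : starRingEnd ℂ μ₂ * μ₂ = 1 := by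
    simpa [Matrix.mul_apply, Fin.sum_univ_two] using congrFun₂ hunit 1 1
  have h₁ : μ₁ ≠ 0 := right_ne_zero_of_mul_eq_one hμ₁
  have h₂ : μ₂ ≠ 0 := right_ne_zero_of_mul_eq_one hμ₂
  rw [charHpq_eq_trace,
    LinearMap.trace_eq_matrix_trace ℂ (Module.Basis.ofEquivFun (hpqEquiv p q)), Matrix.trace,
    Finset.mul_sum, Finset.sum_range]
  refine Finset.sum_congr rfl fun j _ => ?_
  have hone : coeff (leastExponent p q j)
      ((hpqEquiv p q).symm (Pi.single j 1) : MvPolynomial (Var 2) ℂ) /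
        harmonicWeight (leastExponent p q j) = 1 :=
    (congrFun ((hpqEquiv p q).apply_symm_apply (Pi.single j 1)) j).trans (Pi.single_eq_same j 1)
  have hentry : hpqEquiv p q ((uAct 2 d).toLinearMap.restrict (uAct_mem_Hpq d)
      ((hpqEquiv p q).symm (Pi.single j 1))) j =
      coeff (leastExponent p q j)
        (uAct 2 d ((hpqEquiv p q).symm (Pi.single j 1) : MvPolynomial (Var 2) ℂ)) /
          harmonicWeight (leastExponent p q j) := rfl
  rw [Matrix.diag_apply, LinearMap.toMatrix_apply, Module.Basis.ofEquivFun_repr_apply,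
    Module.Basis.coe_ofEquivFun, hentry, coeff_uAct_of_diagonal hd, mul_div_assoc, hone, mul_one,
    eq_inv_of_mul_eq_one_left hμ₁, eq_inv_of_mul_eq_one_left hμ₂]
  obtain ⟨a, b, k, l, hk, ha, hb, hl, hp, hq, hj⟩ : ∃ a b k l : ℕ, p - min j.val p = k ∧
      min j.val p = a ∧ j.val - min j.val p = b ∧ q - (j.val - min j.val p) = l ∧
      p = k + a ∧ q = b + l ∧ j.val = a + b :=
    ⟨_, _, _, _, rfl, rfl, rfl, rfl, by omega, by omega, by omega⟩
  have hexp : leastExponent p q j = Finsupp.equivFunOnFinite.symm (Sum.elim ![k, a] ![b, l]) := by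
    rw [leastExponent, hk, hl, hb, ha]
  rw [hexp, hj, hp, hq]
  simp only [Finsupp.equivFunOnFinite_symm_apply_apply, Sum.elim_inl, Sum.elim_inr,
    Matrix.cons_val_zero, Matrix.cons_val_one]
  simp only [inv_pow, div_pow, pow_add]
  field_simp

theorem charHpq_S3 (g : Matrix.unitaryGroup (Fin 2) ℂ) (μ₁ μ₂ : ℂ)
    (hchar : Matrix.charpoly (g : Matrix (Fin 2) (Fin 2) ℂ) =
      (Polynomial.X - Polynomial.C μ₁) * (Polynomial.X - Polynomial.C μ₂))
    (p q : ℕ) :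
    charHpq 2 p q g = μ₁⁻¹ ^ p * μ₂ ^ q * ∑ j ∈ Finset.range (p + q + 1), (μ₁ / μ₂) ^ j ∧
    Module.finrank ℂ (Hpq 2 p q) = p + q + 1 := by
  obtain ⟨u, d, rfl, hd⟩ := exists_unitary_conj_diagonal g hchar
  refine ⟨by rw [charHpq_conj, charHpq_of_diagonal hd], ?_⟩
  rw [(hpqEquiv p q).finrank_eq, Module.finrank_fin_fun]
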